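/- Let ℱ be a family of finite graphs, χ = χ(ℱ) ≥ 2 and α = α(ℱ). Then: (1) every comparability graph with chromatic number at most χ−1 is ℱ-free; and (2) every ℱ-free finite comparability graph G admits a spanning subgraph that is a comparability graph with chromatic number at most χ−1, obtained by deleting at most 2·(χ²α²/|V(G)|)^{1/(χα²)}·|V(G)|² edges of G. -/

import Mathlib

/-- A strict partial order relation: irreflexive and transitive. -/
def IsStrictOrd {α : Type*} (r : α → α → Prop) : Prop :=
  (∀ x, ¬ r x x) ∧ (∀ ⦃x y z⦄, r x y → r y z → r x z)

/-- A comparability graph: adjacency is comparability in some strict partial order. -/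
def IsComparability {V : Type*} (G : SimpleGraph V) : Prop :=
  ∃ r : V → V → Prop, IsStrictOrd r ∧ ∀ x y, G.Adj x y ↔ (r x y ∨ r y x)

/-- A graph homomorphism: every edge of `F` is mapped to an edge of `G`. -/
def IsGraphHom {W V : Type*} (F : SimpleGraph W) (G : SimpleGraph V) (f : W → V) : Prop :=
  ∀ ⦃x y⦄, F.Adj x y → G.Adj (f x) (f y)

/-- The homomorphism density `t(F,G)`: the probability that a uniformly random map from
`V(F)` to `V(G)` is a graph homomorphism. -/
noncomputable def graphHomDensity {W V : Type*} [Fintype W] [Fintype V]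
    (F : SimpleGraph W) (G : SimpleGraph V) : ℝ :=
  (Nat.card {f : W → V // IsGraphHom F G f} : ℝ) / (Fintype.card V : ℝ) ^ (Fintype.card W)

/-- The chromatic number of a finite graph. -/
noncomputable def chromNum {V : Type*} [Fintype V] (G : SimpleGraph V) : ℕ :=
  sInf {n | G.Colorable n}

/-- The independence number of a finite graph. -/
noncomputable def indepNum {V : Type*} [Fintype V] (G : SimpleGraph V) : ℕ :=
  sSup {n | ∃ s : Finset V, s.card = n ∧ ∀ x ∈ s, ∀ y ∈ s, ¬ G.Adj x y}

/-- `G` is `F`-free: no injective graph homomorphism from `F` to `G`,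
i.e. no (not necessarily induced) subgraph isomorphic to `F`. -/
def GraphFreeOf {W V : Type*} (F : SimpleGraph W) (G : SimpleGraph V) : Prop :=
  ¬ ∃ f : W → V, Function.Injective f ∧ IsGraphHom F G f

/-- The number of edges of `G` deleted to obtain the spanning subgraph `G'`. -/
noncomputable def deletedEdges {V : Type*} [Fintype V] (G G' : SimpleGraph V) : ℕ :=
  Nat.card {e : Sym2 V // e ∈ G.edgeSet ∧ e ∉ G'.edgeSet}

/-- A finite graph with vertex set `Fin n`. -/
structure FinGraph where
  n : ℕ
  graph : SimpleGraph (Fin n)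

/-- The chromatic number of a family of finite graphs: the minimum chromatic number
of a member. -/
noncomputable def famChrom (ℱ : Set FinGraph) : ℕ :=
  sInf {m | ∃ F ∈ ℱ, chromNum F.graph = m}

/-- The independence number of a family of finite graphs: the minimum independence number
of a member of minimum chromatic number. -/
noncomputable def famIndep (ℱ : Set FinGraph) : ℕ :=
  sInf {m | ∃ F ∈ ℱ, chromNum F.graph = famChrom ℱ ∧ indepNum F.graph = m}

/-- Interleave two sequences: even positions from `x`, odd positions from `y`. -/
def interleave {V : Type*} {k : ℕ} (x y : Fin k → V) : Fin k → V :=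
  fun i => if Even (i : ℕ) then x i else y i

theorem interleave_interleave {V : Type*} {k : ℕ} (x y : Fin k → V) :
    interleave (interleave x y) (interleave y x) = x := by
  funext i
  simp only [interleave]
  split_ifs <;> rfl

theorem card_filter_forall_apply {Z : Type*} [Fintype Z] (P : Z → Prop) [DecidablePred P] (a : ℕ)
    [DecidablePred fun f : Fin a → Z => ∀ s, P (f s)] :
    (Finset.univ.filter fun f : Fin a → Z => ∀ s, P (f s)).card =
      (Finset.univ.filter P).card ^ a := by
  have : (Finset.univ.filter fun f : Fin a → Z => ∀ s, P (f s)) =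
      Fintype.piFinset fun _ => Finset.univ.filter P := by
    ext f
    simp
  rw [this, Fintype.card_piFinset_const]

/-- Sidorenko's inequality for complete bipartite graphs `K_{a,a}`, for a bipartite relation. -/
theorem pow_card_le_card_biclique {X Y : Type*} [Fintype X] [Fintype Y] [Nonempty X] [Nonempty Y]
    (R : X → Y → Prop) (a : ℕ) (ha : 1 ≤ a) :
    ((Nat.card {p : X × Y // R p.1 p.2} : ℝ) / (Fintype.card X * Fintype.card Y)) ^ (a ^ 2) *
      ((Fintype.card X : ℝ) ^ a * (Fintype.card Y : ℝ) ^ a) ≤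
      Nat.card {p : (Fin a → X) × (Fin a → Y) // ∀ s t, R (p.1 s) (p.2 t)} := by
  classical
  obtain ⟨b, rfl⟩ : ∃ b, a = b + 1 := ⟨a - 1, by omega⟩
  have hX : (0 : ℝ) < Fintype.card X := by exact_mod_cast Fintype.card_pos
  have hY : (0 : ℝ) < Fintype.card Y := by exact_mod_cast Fintype.card_pos
  set E : ℝ := (Nat.card {p : X × Y // R p.1 p.2} : ℝ) with hE
  have h1 : E = ∑ y : Y, ((Finset.univ.filter fun x => R x y).card : ℝ) := by
    rw [hE, Nat.card_eq_fintype_card, Fintype.card_subtype, Finset.card_filter,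
      Fintype.sum_prod_type_right]
    simp_rw [Finset.card_filter]
    push_cast
    rfl
  have h2 : (Nat.card {p : (Fin (b + 1) → X) × (Fin (b + 1) → Y) // ∀ s t, R (p.1 s) (p.2 t)} : ℝ)
      = ∑ xs : Fin (b + 1) → X,
        ((Finset.univ.filter fun y => ∀ s, R (xs s) y).card : ℝ) ^ (b + 1) := by
    rw [Nat.card_eq_fintype_card, Fintype.card_subtype, Finset.card_filter,
      Fintype.sum_prod_type]
    rw [Nat.cast_sum]
    refine Finset.sum_congr rfl fun xs _ => ?_
    rw [← Nat.cast_pow, ← card_filter_forall_apply, Finset.card_filter]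
    exact congrArg _ (Finset.sum_congr rfl fun ys _ => if_congr forall_comm rfl rfl)
  have h3 : ∑ xs : Fin (b + 1) → X, ((Finset.univ.filter fun y => ∀ s, R (xs s) y).card : ℝ) =
      ∑ y : Y, ((Finset.univ.filter fun x => R x y).card : ℝ) ^ (b + 1) := by
    simp_rw [← Nat.cast_pow, ← card_filter_forall_apply, Finset.card_filter]
    push_cast
    exact Finset.sum_comm
  have h4 := pow_sum_div_card_le_sum_pow (s := Finset.univ)
    (f := fun y : Y => ((Finset.univ.filter fun x => R x y).card : ℝ)) (fun _ _ => by positivity) b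
  have h5 := pow_sum_div_card_le_sum_pow (s := Finset.univ)
    (f := fun xs : Fin (b + 1) → X => ((Finset.univ.filter fun y => ∀ s, R (xs s) y).card : ℝ))
    (fun _ _ => by positivity) b
  rw [← h3, ← h1] at h4
  rw [← h2] at h5
  refine le_trans ?_ h5
  have hE0 : 0 ≤ E := by positivity
  simp only [Finset.card_univ, Fintype.card_fun, Fintype.card_fin] at h4 ⊢
  push_cast
  refine le_trans (le_of_eq ?_)
    (div_le_div_of_nonneg_right (pow_le_pow_left₀ (by positivity) h4 (b + 1)) (by positivity))
  rw [div_pow, div_pow, div_mul_eq_mul_div, div_div, div_eq_div_iff (by positivity) (by positivity)]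
  ring

/-- The sequences that are chains for the relation `r`. -/
def IsRelChain {V : Type*} (r : V → V → Prop) {k : ℕ} (c : Fin k → V) : Prop :=
  ∀ i j, i < j → r (c i) (c j)

/-- The maps of the `a`-fold blow-up of a chain of length `k` that respect the relation `r`. -/
def IsBlowupChain {V : Type*} (r : V → V → Prop) {a k : ℕ} (g : Fin a × Fin k → V) : Prop :=
  ∀ s t i j, i < j → r (g (s, i)) (g (t, j))

theorem isBlowupChain_interleave {V : Type*} {r : V → V → Prop} (hr : IsStrictOrd r) {a k : ℕ}
    {xs ys : Fin a → Fin k → V} (h : ∀ s t, IsRelChain r (interleave (xs s) (ys t))) :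
    IsBlowupChain r fun p : Fin a × Fin k => interleave (xs p.1) (ys p.1) p.2 := by
  have key : ∀ s t i j, i < j → r (interleave (xs s) (ys t) i) (interleave (xs s) (ys t) j) :=
    fun s t => h s t
  intro s t i j hij
  by_cases hi : Even (i : ℕ) <;> by_cases hj : Even (j : ℕ)
  · have hlt : (i : ℕ) + 1 < j := by
      rcases hi with ⟨u, hu⟩
      rcases hj with ⟨v, hv⟩
      have : (i : ℕ) < j := hij
      omega
    have ho : ¬ Even ((i : ℕ) + 1) := by simp [Nat.even_add_one, hi]
    have h1 := key s s i ⟨i + 1, by omega⟩ (Fin.lt_def.2 (by simp))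
    have h2 := key t s ⟨i + 1, by omega⟩ j (Fin.lt_def.2 hlt)
    simp only [interleave, hi, hj, ho, if_true, if_false] at h1 h2 ⊢
    exact hr.2 h1 h2
  · have h1 := key s t i j hij
    simpa only [interleave, hi, hj, if_true, if_false] using h1
  · have h1 := key t s i j hij
    simpa only [interleave, hi, hj, if_true, if_false] using h1
  · have hlt : (i : ℕ) + 1 < j := by
      rw [Nat.not_even_iff_odd] at hi hj
      rcases hi with ⟨u, hu⟩
      rcases hj with ⟨v, hv⟩
      have : (i : ℕ) < j := hij
      omega
    have ho : Even ((i : ℕ) + 1) := by simp [Nat.even_add_one, hi]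
    have h1 := key s s i ⟨i + 1, by omega⟩ (Fin.lt_def.2 (by simp))
    have h2 := key s t ⟨i + 1, by omega⟩ j (Fin.lt_def.2 hlt)
    simp only [interleave, hi, hj, ho, if_true, if_false] at h1 h2 ⊢
    exact hr.2 h1 h2

/-- The number of blown-up chains is bounded below in terms of the density of chains. -/
theorem pow_card_chain_le_card_blowup {V : Type*} [Fintype V] [Nonempty V] {r : V → V → Prop}
    (hr : IsStrictOrd r) (a k : ℕ) (ha : 1 ≤ a) :
    ((Nat.card {c : Fin k → V // IsRelChain r c} : ℝ) / (Fintype.card V : ℝ) ^ k) ^ (a ^ 2) *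
      (Fintype.card V : ℝ) ^ (a * k) ≤
      Nat.card {g : Fin a × Fin k → V // IsBlowupChain r g} := by
  classical
  have hn : (0 : ℝ) < Fintype.card V := by exact_mod_cast Fintype.card_pos
  have h1 := pow_card_le_card_biclique
    (fun x y : Fin k → V => IsRelChain r (interleave x y)) a ha
  have h2 : Nat.card {p : (Fin k → V) × (Fin k → V) // IsRelChain r (interleave p.1 p.2)} =
      Nat.card {c : Fin k → V // IsRelChain r c} * Fintype.card V ^ k := by
    have : Fintype.card V ^ k = Nat.card (Fin k → V) := by simp
    rw [this, ← Nat.card_prod]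
    refine Nat.card_congr
      { toFun := fun p => (⟨interleave p.1.1 p.1.2, p.2⟩, interleave p.1.2 p.1.1)
        invFun := fun q => ⟨(interleave q.1.1 q.2, interleave q.2 q.1.1), by
          simpa only [interleave_interleave] using q.1.2⟩
        left_inv := fun p => by simp [interleave_interleave]
        right_inv := fun q => by simp [interleave_interleave] }
  have h3 : Nat.card {p : (Fin a → Fin k → V) × (Fin a → Fin k → V) //
        ∀ s t, IsRelChain r (interleave (p.1 s) (p.2 t))} ≤
      Nat.card {g : Fin a × Fin k → V // IsBlowupChain r g} * Fintype.card V ^ (a * k) := by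
    have : Fintype.card V ^ (a * k) = Nat.card (Fin a → Fin k → V) := by
      simp [pow_mul, pow_right_comm]
    rw [this, ← Nat.card_prod]
    refine Nat.card_le_card_of_injective (fun p =>
      (⟨fun q => interleave (p.1.1 q.1) (p.1.2 q.1) q.2, isBlowupChain_interleave hr p.2⟩,
        fun s => interleave (p.1.2 s) (p.1.1 s))) ?_
    rintro ⟨⟨x, y⟩, h⟩ ⟨⟨x', y'⟩, h'⟩ heq
    simp only [Prod.mk.injEq, Subtype.mk.injEq] at heq ⊢
    obtain ⟨e1, e2⟩ := heq
    have e1' : ∀ s, interleave (x s) (y s) = interleave (x' s) (y' s) :=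
      fun s => funext fun i => congrFun e1 (s, i)
    have e2' : ∀ s, interleave (y s) (x s) = interleave (y' s) (x' s) := fun s => congrFun e2 s
    constructor <;> funext s
    · rw [← interleave_interleave (x s) (y s), e1', e2', interleave_interleave]
    · rw [← interleave_interleave (y s) (x s), e1', e2', interleave_interleave]
  have h3' := (Nat.cast_le (α := ℝ)).2 h3
  rw [h2] at h1
  have h4 := h1.trans h3'
  simp only [Fintype.card_fun, Fintype.card_fin] at h4
  push_cast at h4
  rw [mul_div_mul_right _ _ (by positivity), ← pow_mul, mul_comm k a, ← mul_assoc] at h4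
  exact le_of_mul_le_mul_right h4 (by positivity)

/-- At most a `1 / |V|` fraction of all functions agree at two given distinct points. -/
theorem card_fun_eq_mul_le {ι V : Type*} [Fintype ι] [Fintype V] {p q : ι} (hpq : p ≠ q) :
    Nat.card {g : ι → V // g p = g q} * Fintype.card V ≤ Fintype.card V ^ Fintype.card ι := by
  classical
  have : Fintype.card V ^ Fintype.card ι = Nat.card (ι → V) := by simp
  rw [this, ← Nat.card_eq_fintype_card, ← Nat.card_prod]
  refine Nat.card_le_card_of_injective (fun x => Function.update x.1.1 p x.2) ?_
  rintro ⟨⟨g, hg⟩, v⟩ ⟨⟨g', hg'⟩, v'⟩ h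
  have hx : ∀ x, Function.update g p v x = Function.update g' p v' x := fun x => congrFun h x
  have hv : v = v' := by simpa using hx p
  have hne : ∀ x, x ≠ p → g x = g' x := fun x hxp => by
    simpa [Function.update_of_ne hxp] using hx x
  have hgg : g = g' := by
    funext x
    by_cases hxp : x = p
    · rw [hxp, hg, hg', hne q hpq.symm]
    · exact hne x hxp
  subst hgg
  subst hv
  rfl

/-- A set of functions that are all non-injective is small. -/
theorem card_noninjective_mul_le {ι V : Type*} [Fintype ι] [Fintype V] (P : (ι → V) → Prop)
    (hP : ∀ g, P g → ¬ Function.Injective g) :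
    Nat.card {g : ι → V // P g} * Fintype.card V ≤
      (Fintype.card ι * Fintype.card ι - Fintype.card ι) * Fintype.card V ^ Fintype.card ι := by
  classical
  have h1 : Nat.card {g : ι → V // P g} ≤
      ∑ x ∈ (Finset.univ : Finset ι).offDiag, Nat.card {g : ι → V // g x.1 = g x.2} := by
    simp only [Nat.card_eq_fintype_card, Fintype.card_subtype]
    refine (Finset.card_le_card ?_).trans Finset.card_biUnion_le
    intro g hg
    have := hP g (by simpa using hg)
    simp only [Function.Injective, not_forall] at this
    obtain ⟨p, q, h, hne⟩ := this
    simp only [Finset.mem_biUnion, Finset.mem_offDiag, Finset.mem_filter, Finset.mem_univ, true_and]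
    exact ⟨(p, q), hne, h⟩
  calc _ ≤ (∑ x ∈ (Finset.univ : Finset ι).offDiag, Nat.card {g : ι → V // g x.1 = g x.2}) *
        Fintype.card V := Nat.mul_le_mul_right _ h1
    _ ≤ ∑ x ∈ (Finset.univ : Finset ι).offDiag, Fintype.card V ^ Fintype.card ι := by
        rw [Finset.sum_mul]
        exact Finset.sum_le_sum fun x hx => card_fun_eq_mul_le (Finset.mem_offDiag.1 hx).2.2
    _ = _ := by rw [Finset.sum_const, Finset.offDiag_card, smul_eq_mul, Finset.card_univ]

/-- `IsRich r c j x`: there are many chains of length `j + 1` starting from `x`, in the sense that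
`x` lies below at least `c` elements `y` with `IsRich r c (j - 1) y`. -/
def IsRich {V : Type*} (r : V → V → Prop) (c : ℝ) : ℕ → V → Prop
  | 0, _ => True
  | j + 1, x => c ≤ (Nat.card {y // r x y ∧ IsRich r c j y} : ℝ)

section Rich

variable {V : Type*} [Fintype V] {r : V → V → Prop} {c : ℝ}

theorem IsRich.of_rel (hr : IsStrictOrd r) {x y : V} (hxy : r x y) :
    ∀ {j}, IsRich r c j y → IsRich r c j x
  | 0, _ => trivial
  | j + 1, h => by
      refine le_trans (show c ≤ _ from h) (Nat.cast_le.2 ?_)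
      exact Nat.card_le_card_of_injective
        (fun z => (⟨z.1, hr.2 hxy z.2.1, z.2.2⟩ : {z // r x z ∧ IsRich r c j z}))
        fun z w h => Subtype.ext (by simpa using h)

theorem pow_le_card_chain_of_isRich (hr : IsStrictOrd r) (hc : 0 ≤ c) :
    ∀ (j : ℕ) (x : V), IsRich r c j x →
      c ^ j ≤ (Nat.card {f : Fin (j + 1) → V // IsRelChain r f ∧ f 0 = x} : ℝ)
  | 0, x, _ => by
      have : Nonempty {f : Fin (0 + 1) → V // IsRelChain r f ∧ f 0 = x} :=
        ⟨⟨fun _ => x, fun i j hij => absurd hij (by simp [Fin.lt_def]), rfl⟩⟩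
      have : 1 ≤ Nat.card {f : Fin (0 + 1) → V // IsRelChain r f ∧ f 0 = x} := Nat.card_pos
      simpa using this
  | j + 1, x, h => by
      classical
      have h' : c ≤ (Nat.card {y // r x y ∧ IsRich r c j y} : ℝ) := h
      have h1 : Nat.card (Σ y : {y // r x y ∧ IsRich r c j y},
            {f : Fin (j + 1) → V // IsRelChain r f ∧ f 0 = y.1}) ≤
          Nat.card {f : Fin (j + 1 + 1) → V // IsRelChain r f ∧ f 0 = x} := by
        refine Nat.card_le_card_of_injective
          (fun p => ⟨Fin.cons x p.2.1, ?_, Fin.cons_zero _ _⟩) ?_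
        · obtain ⟨⟨y, hxy, -⟩, f, hf, h0⟩ := p
          intro u v huv
          have hv : v ≠ 0 := (lt_of_le_of_lt (Fin.zero_le _) huv).ne'
          obtain ⟨v, rfl⟩ := Fin.exists_succ_eq.2 hv
          have hall : ∀ w, r x (f w) := by
            intro w
            by_cases hw : w = 0
            · rw [hw, h0]; exact hxy
            · have := hf 0 w (Fin.pos_of_ne_zero hw)
              rw [h0] at this
              exact hr.2 hxy this
          refine Fin.cases (fun _ => ?_) (fun u huv => ?_) u huv
          · simpa using hall v
          · simpa using hf u v (Fin.succ_lt_succ_iff.1 huv)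
        · rintro ⟨⟨y, hy⟩, f, hf, h0⟩ ⟨⟨y', hy'⟩, f', hf', h0'⟩ heq
          have hff : f = f' := by
            have := congrArg Subtype.val heq
            exact (Fin.cons_injective2 (α := fun _ => V) this).2
          subst hff
          have hyy : y = y' := h0.symm.trans h0'
          subst hyy
          rfl
      refine le_trans ?_ (Nat.cast_le.2 h1)
      rw [Nat.card_sigma]
      push_cast
      calc c ^ (j + 1) = c * c ^ j := by ring
        _ ≤ (Nat.card {y // r x y ∧ IsRich r c j y} : ℝ) * c ^ j := by gcongr
        _ = ∑ _y : {y // r x y ∧ IsRich r c j y}, c ^ j := by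
            rw [Finset.sum_const, Finset.card_univ, nsmul_eq_mul, Nat.card_eq_fintype_card]
        _ ≤ _ := Finset.sum_le_sum fun y _ => pow_le_card_chain_of_isRich hr hc j y.1 y.2.2

theorem pow_le_card_chain (hr : IsStrictOrd r) (hc : 0 ≤ c) (m : ℕ)
    (h : c ≤ (Nat.card {x // IsRich r c m x} : ℝ)) :
    c ^ (m + 1) ≤ (Nat.card {f : Fin (m + 1) → V // IsRelChain r f} : ℝ) := by
  classical
  have h1 : Nat.card (Σ x : {x // IsRich r c m x},
        {f : Fin (m + 1) → V // IsRelChain r f ∧ f 0 = x.1}) ≤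
      Nat.card {f : Fin (m + 1) → V // IsRelChain r f} := by
    refine Nat.card_le_card_of_injective (fun p => ⟨p.2.1, p.2.2.1⟩) ?_
    rintro ⟨⟨y, hy⟩, f, hf, h0⟩ ⟨⟨y', hy'⟩, f', hf', h0'⟩ heq
    have hff : f = f' := congrArg Subtype.val heq
    subst hff
    have hyy : y = y' := h0.symm.trans h0'
    subst hyy
    rfl
  refine le_trans ?_ (Nat.cast_le.2 h1)
  rw [Nat.card_sigma]
  push_cast
  calc c ^ (m + 1) = c * c ^ m := by ring
    _ ≤ (Nat.card {x // IsRich r c m x} : ℝ) * c ^ m := by gcongr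
    _ = ∑ _y : {x // IsRich r c m x}, c ^ m := by
        rw [Finset.sum_const, Finset.card_univ, nsmul_eq_mul, Nat.card_eq_fintype_card]
    _ ≤ _ := Finset.sum_le_sum fun y _ => pow_le_card_chain_of_isRich hr hc m y.1 y.2

open Classical in
/-- If few elements start many long chains, then deleting few comparabilities yields a
comparability graph with small chromatic number. -/
theorem exists_colorable_of_card_isRich_le {G : SimpleGraph V} (hr : IsStrictOrd r)
    (hG : ∀ x y, G.Adj x y ↔ (r x y ∨ r y x)) (m : ℕ) (hm : 1 ≤ m)
    (h : (Nat.card {x // IsRich r c m x} : ℝ) ≤ c) :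
    ∃ G' : SimpleGraph V, G' ≤ G ∧ IsComparability G' ∧ G'.Colorable m ∧
      (deletedEdges G G' : ℝ) ≤ 2 * c * Fintype.card V := by
  set ℓ : V → ℕ := fun x => Nat.findGreatest (fun j => IsRich r c j x) m with hℓ
  have hℓrich : ∀ x, IsRich r c (ℓ x) x := fun x =>
    Nat.findGreatest_spec (P := fun j => IsRich r c j x) (Nat.zero_le m) trivial
  have hℓm : ∀ x, ℓ x ≤ m := fun x => Nat.findGreatest_le m
  have hℓmono : ∀ x y, r x y → ℓ y ≤ ℓ x := fun x y hxy =>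
    Nat.le_findGreatest (hℓm y) ((hℓrich y).of_rel hr hxy)
  have hℓnot : ∀ x, ℓ x < m → ¬ IsRich r c (ℓ x + 1) x := fun x hx =>
    Nat.findGreatest_is_greatest (Nat.lt_succ_self _) hx
  set r' : V → V → Prop := fun x y => r x y ∧ ℓ y < ℓ x ∧ ℓ x < m with hr'
  have hr'o : IsStrictOrd r' := by
    refine ⟨fun x hx => hr.1 x hx.1, fun x y z h1 h2 => ⟨hr.2 h1.1 h2.1, ?_, h1.2.2⟩⟩
    exact h2.2.1.trans h1.2.1
  let G' : SimpleGraph V :=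
    { Adj := fun x y => r' x y ∨ r' y x
      symm := ⟨fun x y h => h.symm⟩
      loopless := ⟨fun x h => hr'o.1 x (h.elim id id)⟩ }
  refine ⟨G', ?_, ⟨r', hr'o, fun x y => Iff.rfl⟩, ?_, ?_⟩
  · intro x y hxy
    exact (hG x y).2 (hxy.imp (fun h => h.1) fun h => h.1)
  · refine ⟨SimpleGraph.Coloring.mk (fun x => ⟨min (ℓ x) (m - 1), by omega⟩) ?_⟩
    intro x y hxy heq
    have heq' : min (ℓ x) (m - 1) = min (ℓ y) (m - 1) := congrArg Fin.val heq
    rcases hxy with ⟨-, h1, h2⟩ | ⟨-, h1, h2⟩ <;> omega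
  · have h1 : deletedEdges G G' ≤
        (Finset.univ.filter fun p : V × V => r p.1 p.2 ∧ ¬ r' p.1 p.2).card := by
      unfold deletedEdges
      rw [Nat.card_eq_fintype_card, Fintype.card_subtype]
      refine (Finset.card_le_card (t := (Finset.univ.filter fun p : V × V =>
        r p.1 p.2 ∧ ¬ r' p.1 p.2).image fun p => s(p.1, p.2)) ?_).trans Finset.card_image_le
      intro e
      induction e using Sym2.ind with
      | _ x y =>
        simp only [Finset.mem_filter, Finset.mem_univ, true_and, SimpleGraph.mem_edgeSet,
          Finset.mem_image]
        rintro ⟨hxy, hnot⟩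
        have hnot' : ¬ r' x y ∧ ¬ r' y x := not_or.1 hnot
        rcases (hG x y).1 hxy with h | h
        · exact ⟨(x, y), ⟨h, hnot'.1⟩, rfl⟩
        · exact ⟨(y, x), ⟨h, hnot'.2⟩, Sym2.eq_swap⟩
    have h2 : ∀ x, ((Finset.univ.filter fun y => r x y ∧ ¬ r' x y).card : ℝ) ≤
        c + if IsRich r c m x then (Fintype.card V : ℝ) else 0 := by
      intro x
      by_cases hx : IsRich r c m x
      · rw [if_pos hx]
        have : (Finset.univ.filter fun y => r x y ∧ ¬ r' x y).card ≤ Fintype.card V :=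
          Finset.card_le_univ _
        have : ((Finset.univ.filter fun y => r x y ∧ ¬ r' x y).card : ℝ) ≤ Fintype.card V := by
          exact_mod_cast this
        linarith
      · rw [if_neg hx, add_zero]
        have hlt : ℓ x < m := lt_of_le_of_ne (hℓm x) fun e => hx (e ▸ hℓrich x)
        have hn : (Nat.card {y // r x y ∧ IsRich r c (ℓ x) y} : ℝ) < c := not_le.1 (hℓnot x hlt)
        refine le_trans (Nat.cast_le.2 ?_) hn.le
        rw [Nat.card_eq_fintype_card, Fintype.card_subtype]
        refine Finset.card_le_card fun y => ?_
        simp only [Finset.mem_filter, Finset.mem_univ, true_and]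
        rintro ⟨hxy, hnot⟩
        refine ⟨hxy, ?_⟩
        have hle : ℓ x ≤ ℓ y := by
          by_contra hcon
          exact hnot ⟨hxy, not_le.1 hcon, hlt⟩
        rw [le_antisymm hle (hℓmono x y hxy)]
        exact hℓrich y
    calc (deletedEdges G G' : ℝ)
        ≤ ((Finset.univ.filter fun p : V × V => r p.1 p.2 ∧ ¬ r' p.1 p.2).card : ℝ) := by
          exact_mod_cast h1
      _ = ∑ x : V, ((Finset.univ.filter fun y => r x y ∧ ¬ r' x y).card : ℝ) := by
          rw [Finset.card_filter, Fintype.sum_prod_type]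
          simp_rw [Finset.card_filter]
          push_cast
          rfl
      _ ≤ ∑ x : V, (c + if IsRich r c m x then (Fintype.card V : ℝ) else 0) :=
          Finset.sum_le_sum fun x _ => h2 x
      _ = Fintype.card V * c + Nat.card {x // IsRich r c m x} * Fintype.card V := by
          rw [Finset.sum_add_distrib, Finset.sum_const, Finset.card_univ, nsmul_eq_mul,
            ← Finset.sum_filter, Finset.sum_const, nsmul_eq_mul, Nat.card_eq_fintype_card,
            Fintype.card_subtype]
      _ ≤ Fintype.card V * c + c * Fintype.card V := by gcongr
      _ = _ := by ring

end Rich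

theorem colorable_chromNum {V : Type*} [Fintype V] (G : SimpleGraph V) :
    G.Colorable (chromNum G) :=
  Nat.sInf_mem (s := {n | G.Colorable n}) ⟨_, G.colorable_of_fintype⟩

theorem chromNum_le {V : Type*} [Fintype V] {G : SimpleGraph V} {n : ℕ} (h : G.Colorable n) :
    chromNum G ≤ n :=
  Nat.sInf_le h

theorem card_le_indepNum {V : Type*} [Fintype V] {G : SimpleGraph V} (s : Finset V)
    (hs : ∀ x ∈ s, ∀ y ∈ s, ¬ G.Adj x y) : s.card ≤ indepNum G := by
  refine le_csSup ⟨Fintype.card V, ?_⟩ ⟨s, rfl, hs⟩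
  rintro n ⟨t, rfl, -⟩
  exact Finset.card_le_univ t

theorem one_le_indepNum {V : Type*} [Fintype V] [Nonempty V] (G : SimpleGraph V) :
    1 ≤ indepNum G := by
  obtain ⟨v⟩ := ‹Nonempty V›
  simpa using card_le_indepNum (G := G) {v} (by simp)

/-- A `k`-colorable finite graph of independence number at most `a` embeds into the complete
multipartite graph with `k` parts of size `a`. -/
theorem exists_embedding_blowup {V : Type*} [Fintype V] {F : SimpleGraph V} {a k : ℕ}
    (hk : F.Colorable k) (ha : indepNum F ≤ a) :
    ∃ f : V → Fin a × Fin k, Function.Injective f ∧ ∀ x y, F.Adj x y → (f x).2 ≠ (f y).2 := by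
  classical
  obtain ⟨C⟩ := hk
  have h : ∀ i, Nonempty ({v // C v = i} ↪ Fin a) := by
    intro i
    refine Function.Embedding.nonempty_of_card_le ?_
    rw [Fintype.card_fin, Fintype.card_subtype]
    refine (card_le_indepNum _ fun x hx y hy hxy => C.valid hxy ?_).trans ha
    rw [(Finset.mem_filter.1 hx).2, (Finset.mem_filter.1 hy).2]
  let e := fun i => (h i).some
  refine ⟨fun v => (e (C v) ⟨v, rfl⟩, C v), ?_, fun x y hxy => C.valid hxy⟩
  intro x y hxy
  simp only [Prod.mk.injEq] at hxy
  obtain ⟨h1, h2⟩ := hxy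
  have key : ∀ i (hx : C x = i) (hy : C y = i), e i ⟨x, hx⟩ = e i ⟨y, hy⟩ → x = y :=
    fun i hx hy hi => congrArg Subtype.val ((e i).injective hi)
  refine key (C y) h2 rfl ?_
  rw [← h1]
  have : ∀ i (hi : C x = i), e i ⟨x, hi⟩ ≍ e (C x) ⟨x, rfl⟩ := by
    rintro _ rfl
    rfl
  exact eq_of_heq (this _ h2)

/-- The number of elements that start many chains is small in the absence of a blown-up chain. -/
theorem card_isRich_le {V : Type*} [Fintype V] [Nonempty V] {r : V → V → Prop}
    (hr : IsStrictOrd r) {ε : ℝ} (hε : 0 ≤ ε) (a m : ℕ) (ha : 1 ≤ a)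
    (hεeq : ε ^ ((m + 1) * a ^ 2) = ((m + 1 : ℕ) : ℝ) ^ 2 * (a : ℝ) ^ 2 / Fintype.card V)
    (hfree : ∀ g : Fin a × Fin (m + 1) → V, IsBlowupChain r g → ¬ Function.Injective g) :
    (Nat.card {x // IsRich r (ε * Fintype.card V) m x} : ℝ) ≤ ε * Fintype.card V := by
  by_contra! hcon
  have hn : (0 : ℝ) < Fintype.card V := by exact_mod_cast Fintype.card_pos
  have h1 := pow_le_card_chain hr (by positivity) m hcon.le
  have h2 := pow_card_chain_le_card_blowup hr a (m + 1) ha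
  have h3 := card_noninjective_mul_le (IsBlowupChain r) hfree
  rw [Fintype.card_prod, Fintype.card_fin, Fintype.card_fin] at h3
  have hpos : 0 < a * (m + 1) := by positivity
  have h4 : Nat.card {g : Fin a × Fin (m + 1) → V // IsBlowupChain r g} * Fintype.card V <
      a * (m + 1) * (a * (m + 1)) * Fintype.card V ^ (a * (m + 1)) := by
    refine lt_of_le_of_lt h3 (Nat.mul_lt_mul_of_pos_right ?_ (pow_pos Fintype.card_pos _))
    exact Nat.sub_lt (by positivity) hpos
  have h5 : (Nat.card {g : Fin a × Fin (m + 1) → V // IsBlowupChain r g} : ℝ) * Fintype.card V <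
      (a * ((m + 1 : ℕ) : ℝ)) * (a * ((m + 1 : ℕ) : ℝ)) *
        (Fintype.card V : ℝ) ^ (a * (m + 1)) := by
    exact_mod_cast h4
  have h6 : ε ^ (m + 1) ≤ (Nat.card {c : Fin (m + 1) → V // IsRelChain r c} : ℝ) /
      (Fintype.card V : ℝ) ^ (m + 1) := by
    rw [le_div_iff₀ (by positivity), ← mul_pow]
    exact h1
  have h7 : ε ^ ((m + 1) * a ^ 2) * (Fintype.card V : ℝ) ^ (a * (m + 1)) ≤
      Nat.card {g : Fin a × Fin (m + 1) → V // IsBlowupChain r g} := by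
    refine le_trans ?_ h2
    rw [pow_mul]
    gcongr
  rw [hεeq] at h7
  have h8 := mul_le_mul_of_nonneg_right h7 hn.le
  refine absurd (h8.trans_lt h5) (not_lt.2 (le_of_eq ?_))
  field_simp

/-- **Indistinguishability for comparability graphs** (Theorem 11). Let `χ = χ(ℱ) ≥ 2`
and `α = α(ℱ)`. (1) Every comparability graph with chromatic number at most `χ-1`
is `ℱ`-free. (2) Every `ℱ`-free finite comparability graph `G` admits a spanning
subgraph that is a comparability graph of chromatic number at most `χ-1`,
obtained by deleting at most `2·(χ²α²/|V(G)|)^{1/(χα²)}·|V(G)|²` edges. -/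
theorem comparability_indistinguishability (ℱ : Set FinGraph) (h2 : 2 ≤ famChrom ℱ) :
    (∀ (V : Type) [Fintype V], ∀ G : SimpleGraph V, IsComparability G →
      chromNum G ≤ famChrom ℱ - 1 → ∀ F ∈ ℱ, GraphFreeOf F.graph G) ∧
    (∀ (V : Type) [Fintype V], ∀ G : SimpleGraph V, IsComparability G →
      (∀ F ∈ ℱ, GraphFreeOf F.graph G) →
      ∃ G' : SimpleGraph V, G' ≤ G ∧ IsComparability G' ∧
        chromNum G' ≤ famChrom ℱ - 1 ∧
        (deletedEdges G G' : ℝ) ≤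
          2 * (((famChrom ℱ : ℝ) ^ 2 * (famIndep ℱ : ℝ) ^ 2 / (Fintype.card V : ℝ)) ^
              ((1 : ℝ) / ((famChrom ℱ : ℝ) * (famIndep ℱ : ℝ) ^ 2))) *
            (Fintype.card V : ℝ) ^ 2) := by
  have hne : {m | ∃ F ∈ ℱ, chromNum F.graph = m}.Nonempty := by
    by_contra h
    rw [Set.not_nonempty_iff_eq_empty] at h
    simp [famChrom, h] at h2
  refine ⟨?_, ?_⟩
  · rintro V _ G - hG F hF ⟨f, -, hf⟩
    have h1 : F.graph.Colorable (chromNum G) := (colorable_chromNum G).of_hom ⟨f, fun h => hf h⟩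
    have h3 : famChrom ℱ ≤ chromNum F.graph := Nat.sInf_le ⟨F, hF, rfl⟩
    have := chromNum_le h1
    omega
  · rintro V _ G ⟨r, hr, hG⟩ hfree
    obtain ⟨F₀, hF₀, hχ₀⟩ := Nat.sInf_mem hne
    obtain ⟨F, hF, hχ, hα⟩ := Nat.sInf_mem
      (s := {m | ∃ F ∈ ℱ, chromNum F.graph = famChrom ℱ ∧ indepNum F.graph = m})
      ⟨_, F₀, hF₀, hχ₀, rfl⟩
    change indepNum F.graph = famIndep ℱ at hα
    obtain ⟨m, hm⟩ : ∃ m, famChrom ℱ = m + 1 := ⟨famChrom ℱ - 1, by omega⟩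
    rcases isEmpty_or_nonempty V with hV | hV
    · refine ⟨G, le_rfl, ⟨r, hr, hG⟩, chromNum_le (SimpleGraph.Colorable.of_isEmpty _), ?_⟩
      have : deletedEdges G G = 0 := by
        have : IsEmpty {e : Sym2 V // e ∈ G.edgeSet ∧ e ∉ G.edgeSet} := ⟨fun e => e.2.2 e.2.1⟩
        exact Nat.card_of_isEmpty
      rw [this, Nat.cast_zero]
      positivity
    have ha : 1 ≤ famIndep ℱ := by
      rw [← hα]
      have : Nonempty (Fin F.n) := by
        by_contra hemp
        rw [not_nonempty_iff] at hemp
        have := chromNum_le (SimpleGraph.Colorable.of_isEmpty (G := F.graph) 0)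
        omega
      exact one_le_indepNum _
    have hn : (0 : ℝ) < Fintype.card V := by exact_mod_cast Fintype.card_pos
    have hG' : ∀ g : Fin (famIndep ℱ) × Fin (m + 1) → V,
        IsBlowupChain r g → ¬ Function.Injective g := by
      intro g hg hinj
      obtain ⟨f, hf, hadj⟩ := exists_embedding_blowup (k := m + 1)
        (hm ▸ hχ ▸ colorable_chromNum F.graph) hα.le
      refine hfree F hF ⟨fun v => g (f v), hinj.comp hf, fun x y hxy => (hG _ _).2 ?_⟩
      exact (lt_or_gt_of_ne (hadj x y hxy)).imp (hg _ _ _ _) (hg _ _ _ _)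
    rw [hm]
    generalize famIndep ℱ = a at ha hG'
    set ε : ℝ := (((m + 1 : ℕ) : ℝ) ^ 2 * (a : ℝ) ^ 2 / (Fintype.card V : ℝ)) ^
      ((1 : ℝ) / (((m + 1 : ℕ) : ℝ) * (a : ℝ) ^ 2)) with hε
    have hε0 : 0 ≤ ε := by positivity
    have ha0 : (a : ℝ) ≠ 0 := by positivity
    have hεeq : ε ^ ((m + 1) * a ^ 2) =
        ((m + 1 : ℕ) : ℝ) ^ 2 * (a : ℝ) ^ 2 / Fintype.card V := by
      rw [hε, ← Real.rpow_natCast, ← Real.rpow_mul (by positivity), Nat.cast_mul, Nat.cast_pow,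
        one_div, inv_mul_cancel₀ (by positivity), Real.rpow_one]
    obtain ⟨G', hle, hcomp, hcol, hdel⟩ := exists_colorable_of_card_isRich_le hr hG m
      (by omega) (card_isRich_le hr hε0 a m ha hεeq hG')
    refine ⟨G', hle, hcomp, chromNum_le hcol, hdel.trans (le_of_eq ?_)⟩
    ring
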